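/- arXiv:math/0307312 — 2 statements merged into one kernel-verified Lean document; each statement's English description precedes it below -/
import Mathlib

section
/- Let E be an L_{∞,λ} space, F a Banach space, and g : E → F analytic at a with dg(a) = 0. Then g is almost 2-summing at a; in fact there exist D, δ > 0 with ‖(g(a+x_j) - g(a))_{j=1}^m‖_{w,1} ≤ D ‖(x_j)_{j=1}^m‖_{w,2} for all m and all x_1,...,x_m with ‖(x_j)_{j=1}^m‖_{w,2} < δ. -/
open MeasureTheory Filter Finset

/-- The weak ℓ_q norm of a finite family: `sup_{‖φ‖≤1} (∑ |φ x_j|^q)^{1/q}`. -/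
noncomputable def weakNorm {E : Type*} [NormedAddCommGroup E] [NormedSpace ℝ E]
    (q : ℝ) {k : ℕ} (x : Fin k → E) : ℝ :=
  sSup {s : ℝ | ∃ φ : E →L[ℝ] ℝ, ‖φ‖ ≤ 1 ∧ s = (∑ j, |φ (x j)| ^ q) ^ (1 / q)}

/-- The weak ℓ_q norm of a sequence. -/
noncomputable def weakNormSeq {E : Type*} [NormedAddCommGroup E] [NormedSpace ℝ E]
    (q : ℝ) (x : ℕ → E) : ℝ :=
  sSup {s : ℝ | ∃ φ : E →L[ℝ] ℝ, ‖φ‖ ≤ 1 ∧ s = (∑' j, |φ (x j)| ^ q) ^ (1 / q)}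

/-- Unconditionally q-summable sequences: weakly q-summable with weak norms of tails → 0. -/
def UncondSummable {E : Type*} [NormedAddCommGroup E] [NormedSpace ℝ E]
    (q : ℝ) (x : ℕ → E) : Prop :=
  (∀ φ : E →L[ℝ] ℝ, Summable fun j => |φ (x j)| ^ q) ∧
    Tendsto (fun m => weakNormSeq q fun j => x (j + m)) atTop (nhds 0)

/-- The Rademacher functions on [0,1]. -/
noncomputable def rademacher (j : ℕ) (t : ℝ) : ℝ :=
  if Int.fract ((2 : ℝ) ^ j * t) < 1 / 2 then 1 else -1

/-- `(∫_0^1 ‖∑_j r_j(t) y_j‖² dt)^{1/2}` for a finite family `y` in `F`. -/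
noncomputable def radNorm {F : Type*} [NormedAddCommGroup F] [NormedSpace ℝ F]
    {k : ℕ} (y : Fin k → F) : ℝ :=
  (∫ t in (0:ℝ)..1, ‖∑ j : Fin k, rademacher (j : ℕ) t • y j‖ ^ 2) ^ ((1:ℝ) / 2)

/-- `f` is almost p-summing at `a`. -/
def AlmostSummingAt {E F : Type*} [NormedAddCommGroup E] [NormedSpace ℝ E]
    [NormedAddCommGroup F] [NormedSpace ℝ F] (p : ℝ) (f : E → F) (a : E) : Prop :=
  ∃ C > 0, ∃ ε > 0, ∃ r > 0, ∀ (k : ℕ) (x : Fin k → E), weakNorm p x < ε →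
    radNorm (fun j => f (a + x j) - f a) ≤ C * weakNorm p x ^ r

/-- `f` is absolutely (p,q)-summing at `a`. -/
def AbsSummingAt {E F : Type*} [NormedAddCommGroup E] [NormedSpace ℝ E]
    [NormedAddCommGroup F] [NormedSpace ℝ F] (p q : ℝ) (f : E → F) (a : E) : Prop :=
  ∃ M > 0, ∃ δ > 0, ∃ r > 0, ∀ (k : ℕ) (x : Fin k → E), weakNorm q x < δ →
    (∑ j, ‖f (a + x j) - f a‖ ^ p) ≤ M * weakNorm q x ^ r

/-- `E` is an `L_{∞,λ}` space: every finite-dimensional subspace is contained in a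
finite-dimensional subspace λ-isomorphic to some `ℓ_∞^m`. -/
def IsLinftySpace (lam : ℝ) (E : Type*) [NormedAddCommGroup E] [NormedSpace ℝ E] : Prop :=
  ∀ G : Subspace ℝ E, FiniteDimensional ℝ G →
    ∃ H : Subspace ℝ E, G ≤ H ∧ FiniteDimensional ℝ H ∧
      ∃ m : ℕ, ∃ e : H ≃L[ℝ] (Fin m → ℝ),
        ‖(e : H →L[ℝ] (Fin m → ℝ))‖ * ‖(e.symm : (Fin m → ℝ) →L[ℝ] H)‖ ≤ lam


lemma aux_improve (S : Set ℝ) (K0 c θ C : ℝ) (hθ : θ < 1) (hb : ∀ v ∈ S, v ≤ K0)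
    (hstep : ∀ K, (∀ v ∈ S, v ≤ K) → ∀ v ∈ S, v ≤ c + θ * K) (hC : c ≤ (1 - θ) * C) :
    ∀ v ∈ S, v ≤ C := by
  intro v hv
  have hbd : BddAbove S := ⟨K0, hb⟩
  have h1 : ∀ v ∈ S, v ≤ sSup S := fun v hv => le_csSup hbd hv
  have h2 := csSup_le ⟨v, hv⟩ (hstep _ h1)
  have h3 := h1 v hv
  have h4 : (1 - θ) * sSup S ≤ (1 - θ) * C := by linarith
  have h5 := le_of_mul_le_mul_left h4 (by linarith)
  linarith

lemma aux_rad (N : ℕ) : ∃ L : ℕ, 0 < L ∧ ∃ r : Fin N → Fin L → ℝ,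
    (∀ j s, |r j s| ≤ 1) ∧
    (∀ i j, ∑ s, r i s * r j s = if i = j then (L : ℝ) else 0) ∧
    (∀ a : Fin N → ℝ, ∑ s, (∑ j, r j s * a j) ^ 2 = L * ∑ j, a j ^ 2) ∧
    (∀ a : Fin N → ℝ, ∑ s, (∑ j, r j s * a j) ^ 4 ≤ 3 * L * (∑ j, a j ^ 2) ^ 2) := by
  induction N with
  | zero => exact ⟨1, one_pos, fun j => j.elim0, fun j => j.elim0, fun j => j.elim0, by simp, by simp⟩
  | succ N ih =>
    obtain ⟨L, hL, r, h1, h0, h2, h4⟩ := ih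
    refine ⟨L + L, by omega, Fin.cons (Fin.append (fun _ => 1) (fun _ => -1))
      (fun j => Fin.append (r j) (r j)), ?_, ?_, ?_, ?_⟩
    · intro j s
      refine Fin.cases ?_ (fun j => ?_) j <;> refine Fin.addCases (fun s => ?_) (fun s => ?_) s <;>
        simp [h1, -Fin.natAdd_eq_addNat]
    · intro i j
      refine Fin.cases ?_ (fun i => ?_) i <;> refine Fin.cases ?_ (fun j => ?_) j <;>
        simp [Fin.sum_univ_add, h0, Fin.succ_ne_zero, (Fin.succ_ne_zero _).symm,
          -Fin.natAdd_eq_addNat]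
      split_ifs <;> simp
    · intro a
      have e := h2 (fun j => a j.succ)
      simp only [Fin.sum_univ_add, Fin.sum_univ_succ, Fin.cons_zero, Fin.cons_succ,
        Fin.append_left, Fin.append_right]
      rw [← Finset.sum_add_distrib]
      have : ∀ s, (1 * a 0 + ∑ j : Fin N, r j s * a j.succ) ^ 2 +
          (-1 * a 0 + ∑ j : Fin N, r j s * a j.succ) ^ 2 =
          2 * (∑ j : Fin N, r j s * a j.succ) ^ 2 + 2 * a 0 ^ 2 := fun s => by ring
      simp only [this, Finset.sum_add_distrib, ← Finset.mul_sum, e]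
      simp
      ring
    · intro a
      have e := h2 (fun j => a j.succ)
      have e4 := h4 (fun j => a j.succ)
      simp only [Fin.sum_univ_add, Fin.sum_univ_succ, Fin.cons_zero, Fin.cons_succ,
        Fin.append_left, Fin.append_right]
      rw [← Finset.sum_add_distrib]
      have : ∀ s, (1 * a 0 + ∑ j : Fin N, r j s * a j.succ) ^ 4 +
          (-1 * a 0 + ∑ j : Fin N, r j s * a j.succ) ^ 4 =
          2 * (∑ j : Fin N, r j s * a j.succ) ^ 4 +
          12 * a 0 ^ 2 * (∑ j : Fin N, r j s * a j.succ) ^ 2 + 2 * a 0 ^ 4 := fun s => by ring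
      simp only [this, Finset.sum_add_distrib, ← Finset.mul_sum, e]
      simp
      have : 0 ≤ (L : ℝ) * a 0 ^ 4 := by positivity
      nlinarith

/-- truncation -/
noncomputable def auxClamp (x : ℝ) : ℝ := max (-7) (min x 7)

lemma auxClamp_abs (x : ℝ) : |auxClamp x| ≤ 7 := by
  unfold auxClamp
  rw [abs_le]; constructor
  · exact le_max_left _ _
  · exact max_le (by norm_num) (min_le_right _ _)

lemma auxClamp_sq (x : ℝ) : auxClamp x ^ 2 ≤ x ^ 2 := by
  unfold auxClamp
  rcases le_total x 7 with h | h <;> rcases le_total (-7) x with h' | h' <;>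
    simp [h, h'] <;> nlinarith

lemma auxTail_sq (x : ℝ) : 49 * (x - auxClamp x) ^ 2 ≤ x ^ 4 := by
  unfold auxClamp
  rcases le_total x 7 with h | h
  · rcases le_total (-7) x with h' | h'
    · simp [h, h']; positivity
    · simp [h, h']
      have : (x + 7) ^ 2 ≤ x ^ 2 := by nlinarith
      have : 49 ≤ x ^ 2 := by nlinarith
      nlinarith
  · have h7 : min x 7 = 7 := min_eq_right h
    rw [h7, max_eq_right (by norm_num)]
    have : (x - 7) ^ 2 ≤ x ^ 2 := by nlinarith
    have : 49 ≤ x ^ 2 := by nlinarith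
    nlinarith

lemma aux_split (N : ℕ) : ∃ L : ℕ, 0 < L ∧ ∃ r : Fin N → Fin L → ℝ,
    (∀ j s, |r j s| ≤ 1) ∧
    (∀ i j, ∑ s, r i s * r j s = if i = j then (L : ℝ) else 0) ∧
    (∀ a : Fin N → ℝ, ∑ s, (∑ j, r j s * a j) ^ 2 = L * ∑ j, a j ^ 2) ∧
    ∀ (n : ℕ) (x : Fin N → Fin n → ℝ), (∀ p, ∑ j, x j p ^ 2 ≤ 1) →
      ∃ Xb Xt : Fin L → Fin n → ℝ, (∀ s, Xb s + Xt s = ∑ j, r j s • x j) ∧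
        (∀ s, ‖Xb s‖ ≤ 7) ∧ (∀ p, ∑ s, (Xb s p + Xt s p) ^ 2 ≤ (L : ℝ)) ∧
        (∀ p, ∑ s, Xb s p ^ 2 ≤ (L : ℝ)) ∧
        (∀ p, ∑ s, (4 * Xt s p) ^ 2 ≤ (L : ℝ)) ∧
        (∀ j, (L : ℝ) • x j = ∑ s, r j s • (Xb s + Xt s)) := by
  obtain ⟨L, hL, r, h1, h0, h2, h4⟩ := aux_rad N
  refine ⟨L, hL, r, h1, h0, h2, fun n x hx => ?_⟩
  refine ⟨fun s p => auxClamp (∑ j, r j s * x j p),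
    fun s p => (∑ j, r j s * x j p) - auxClamp (∑ j, r j s * x j p), ?_, ?_, ?_, ?_, ?_, ?_⟩
  · intro s; ext p; simp
  · intro s
    rw [pi_norm_le_iff_of_nonneg (by norm_num)]
    intro p; exact auxClamp_abs _
  · intro p
    simp only [add_sub_cancel]
    rw [h2 (fun j => x j p)]
    exact mul_le_of_le_one_right (by positivity) (hx p)
  · intro p
    refine (Finset.sum_le_sum fun s _ => auxClamp_sq _).trans ?_
    rw [h2 (fun j => x j p)]
    exact mul_le_of_le_one_right (by positivity) (hx p)
  · intro p
    have e4 := h4 (fun j => x j p)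
    have : ∑ s, (4 * ((∑ j, r j s * x j p) - auxClamp (∑ j, r j s * x j p))) ^ 2 ≤
        ∑ s, (16 / 49) * (∑ j, r j s * x j p) ^ 4 :=
      Finset.sum_le_sum fun s _ => by
        have := auxTail_sq (∑ j, r j s * x j p)
        nlinarith
    rw [← Finset.mul_sum] at this
    have hp := hx p
    have hp0 : 0 ≤ ∑ j, x j p ^ 2 := Finset.sum_nonneg fun _ _ => sq_nonneg _
    have hq : (∑ j, x j p ^ 2) ^ 2 ≤ 1 := by nlinarith
    have hL' : (0 : ℝ) < L := by exact_mod_cast hL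
    have : 3 * (L : ℝ) * (∑ j, x j p ^ 2) ^ 2 ≤ 3 * L := mul_le_of_le_one_right (by positivity) hq
    linarith
  · intro j; ext p
    simp only [Pi.smul_apply, smul_eq_mul, Finset.sum_apply, Pi.add_apply, add_sub_cancel,
      Finset.mul_sum]
    rw [Finset.sum_comm]
    simp only [← mul_assoc, ← Finset.sum_mul, h0]
    simp

lemma aux_bilin {n : ℕ} (B : (Fin n → ℝ) →ₗ[ℝ] (Fin n → ℝ) →ₗ[ℝ] ℝ) (D : ℝ)
    (hD : 0 ≤ D) (hB : ∀ x y, |B x y| ≤ D * ‖x‖ * ‖y‖) :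
    ∀ (N : ℕ) (x y : Fin N → Fin n → ℝ), (∀ p, ∑ j, x j p ^ 2 ≤ 1) →
      (∀ p, ∑ j, y j p ^ 2 ≤ 1) → |∑ j, B (x j) (y j)| ≤ 98 * D := by
  have key := aux_improve {v : ℝ | ∃ (N : ℕ) (x y : Fin N → Fin n → ℝ),
      (∀ p, ∑ j, x j p ^ 2 ≤ 1) ∧ (∀ p, ∑ j, y j p ^ 2 ≤ 1) ∧ v = |∑ j, B (x j) (y j)|}
    (n * D) (49 * D) (1 / 2) (98 * D) (by norm_num) ?_ ?_ (by linarith)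
  · intro N x y hx hy; exact key _ ⟨N, x, y, hx, hy, rfl⟩
  · rintro v ⟨N, x, y, hx, hy, rfl⟩
    have e : ∑ j, B (x j) (y j) = ∑ p, B (Pi.single p 1) (∑ j, x j p • y j) := by
      have : ∀ j, B (x j) (y j) = ∑ p, x j p * B (Pi.single p 1) (y j) := by
        intro j
        conv_lhs => rw [pi_eq_sum_univ' (x j)]
        simp
      simp only [this, map_sum, map_smul, smul_eq_mul]
      rw [Finset.sum_comm]
    rw [e]
    refine (Finset.abs_sum_le_sum_abs _ _).trans ?_
    have : ∀ p ∈ (Finset.univ : Finset (Fin n)), |B (Pi.single p 1) (∑ j, x j p • y j)| ≤ D := by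
      intro p _
      refine (hB _ _).trans ?_
      have h1 : ‖(Pi.single p 1 : Fin n → ℝ)‖ ≤ 1 := by
        rw [pi_norm_le_iff_of_nonneg (by norm_num)]
        intro q
        by_cases h : q = p
        · subst h; simp
        · simp [h]
      have h2 : ‖∑ j, x j p • y j‖ ≤ 1 := by
        rw [pi_norm_le_iff_of_nonneg (by norm_num)]
        intro q
        simp only [Finset.sum_apply, Pi.smul_apply, smul_eq_mul, Real.norm_eq_abs]
        have cs := Finset.sum_mul_sq_le_sq_mul_sq Finset.univ (fun j => x j p) (fun j => y j q)
        have : (∑ j, x j p ^ 2) * (∑ j, y j q ^ 2) ≤ 1 :=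
          mul_le_one₀ (hx p) (Finset.sum_nonneg fun _ _ => sq_nonneg _) (hy q)
        exact (sq_le_one_iff_abs_le_one _).1 (cs.trans this)
      calc D * _ * _ ≤ D * 1 * 1 := by gcongr
        _ = D := by ring
    refine (Finset.sum_le_sum this).trans ?_
    simp
  · rintro K hK v ⟨N, x, y, hx, hy, rfl⟩
    obtain ⟨L, hL, r, -, h0, -, hs⟩ := aux_split N
    obtain ⟨Xb, Xt, X1, X2, X3, X4, X5, X6⟩ := hs n x hx
    obtain ⟨Yb, Yt, Y1, Y2, Y3, Y4, Y5, Y6⟩ := hs n y hy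
    have hL' : (0 : ℝ) < L := by exact_mod_cast hL
    have e : L * ∑ j, B (x j) (y j) = ∑ s, B (Xb s + Xt s) (Yb s + Yt s) := by
      rw [Finset.mul_sum]
      have : ∀ j, L * B (x j) (y j) = ∑ s, r j s * B (Xb s + Xt s) (y j) := by
        intro j
        have := congrArg (fun z => B z (y j)) (X6 j)
        simpa [mul_add] using this
      simp only [this]
      rw [Finset.sum_comm]
      refine Finset.sum_congr rfl fun s _ => ?_
      rw [Y1 s]; simp
    have hsc : ∀ (u v : Fin L → Fin n → ℝ), (∀ p, ∑ s, u s p ^ 2 ≤ (L : ℝ)) →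
        (∀ p, ∑ s, v s p ^ 2 ≤ (L : ℝ)) → |∑ s, B (u s) (v s)| ≤ L * K := by
      intro u v hu hv
      have hc : ((Real.sqrt L)⁻¹) ^ 2 = (L : ℝ)⁻¹ := by
        rw [inv_pow, Real.sq_sqrt hL'.le]
      have hsq : ∀ (u : Fin L → Fin n → ℝ), (∀ p, ∑ s, u s p ^ 2 ≤ (L : ℝ)) →
          ∀ p, ∑ s, ((Real.sqrt L)⁻¹ • u s) p ^ 2 ≤ 1 := by
        intro u hu p
        simp only [Pi.smul_apply, smul_eq_mul, mul_pow, hc, ← Finset.mul_sum]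
        rw [inv_mul_le_iff₀ hL']; simpa using hu p
      have := hK _ ⟨L, fun s => (Real.sqrt L)⁻¹ • u s, fun s => (Real.sqrt L)⁻¹ • v s,
        hsq u hu, hsq v hv, rfl⟩
      simp only [map_smul, LinearMap.smul_apply, smul_eq_mul, ← Finset.mul_sum] at this
      rw [← mul_assoc, ← sq, hc, abs_mul, abs_of_pos (inv_pos.2 hL'), inv_mul_le_iff₀ hL'] at this
      exact this
    have b1 : |∑ s, B (Xb s) (Yb s)| ≤ L * (49 * D) := by
      refine (Finset.abs_sum_le_sum_abs _ _).trans ?_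
      have : ∀ s ∈ (Finset.univ : Finset (Fin L)), |B (Xb s) (Yb s)| ≤ 49 * D := by
        intro s _
        refine (hB _ _).trans ?_
        calc D * _ * _ ≤ D * 7 * 7 := by gcongr; exacts [X2 s, Y2 s]
          _ = 49 * D := by ring
      refine (Finset.sum_le_sum this).trans ?_
      simp
    have b2 := hsc (fun s => (4 : ℝ) • Xt s) Yb (by simpa using X5) Y4
    have b3 := hsc (fun s => Xb s + Xt s) (fun s => (4 : ℝ) • Yt s) (by simpa using X3)
      (by simpa using Y5)
    have e2 : L * ∑ j, B (x j) (y j) = ∑ s, B (Xb s) (Yb s) +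
        (1/4) * ∑ s, B ((4 : ℝ) • Xt s) (Yb s) + (1/4) * ∑ s, B (Xb s + Xt s) ((4 : ℝ) • Yt s) := by
      rw [e, Finset.mul_sum, Finset.mul_sum, ← Finset.sum_add_distrib, ← Finset.sum_add_distrib]
      refine Finset.sum_congr rfl fun s _ => ?_
      simp
      ring
    rw [abs_le] at b1 b2 b3
    have : |L * ∑ j, B (x j) (y j)| ≤ L * (49 * D + 1 / 2 * K) := by
      rw [e2, abs_le]; constructor <;> linarith [b1.1, b1.2, b2.1, b2.2, b3.1, b3.2]
    rw [abs_mul, abs_of_pos hL'] at this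
    exact le_of_mul_le_mul_left this hL'

lemma aux_coord {n N : ℕ} (x : Fin N → Fin n → ℝ) (hx : ∀ p, ∑ j, x j p ^ 2 ≤ 1) (j : Fin N) :
    ‖x j‖ ≤ 1 := by
  rw [pi_norm_le_iff_of_nonneg (by norm_num)]
  intro p
  have := (Finset.single_le_sum (f := fun j => x j p ^ 2) (fun _ _ => sq_nonneg _)
    (Finset.mem_univ j)).trans (hx p)
  exact (sq_le_one_iff_abs_le_one _).1 this

lemma aux_multi {n : ℕ} (k : ℕ) (A : ContinuousMultilinearMap ℝ (fun _ : Fin (k + 2) => Fin n → ℝ) ℝ)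
    (N : ℕ) (x : Fin N → Fin (k + 2) → Fin n → ℝ) (hx : ∀ i p, ∑ j, x j i p ^ 2 ≤ 1) :
    ∑ j, |A (x j)| ≤ 10 ^ (k + 2) * ‖A‖ := by
  induction k with
  | zero =>
    let B : (Fin n → ℝ) →ₗ[ℝ] (Fin n → ℝ) →ₗ[ℝ] ℝ :=
      LinearMap.mk₂ ℝ (fun u v => continuousMultilinearCurryFin1 ℝ (Fin n → ℝ) ℝ (A.curryLeft u) v)
        (by intros; simp) (by intros; simp) (fun _ _ _ => map_add _ _ _)
        (fun _ _ _ => map_smul _ _ _)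
    have hBA : ∀ u v, B u v = A ![u, v] := by
      intro u v
      simp [B]
    have hB := aux_bilin B ‖A‖ (norm_nonneg _) (by
      intro u v
      rw [hBA]
      have := A.le_opNorm ![u, v]
      simpa [Fin.prod_univ_two, mul_assoc] using this)
    have hsg : ∀ t : ℝ, ∃ σ : ℝ, σ ^ 2 = 1 ∧ |t| = σ * t := by
      intro t
      rcases le_total 0 t with h | h
      · exact ⟨1, by simp, by simp [abs_of_nonneg h]⟩
      · exact ⟨-1, by simp, by simp [abs_of_nonpos h]⟩
    choose σ h1 h2 using hsg
    have := hB N (fun j => σ (A (x j)) • x j 0) (fun j => x j 1)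
      (by intro p; simpa [mul_pow, h1] using hx 0 p) (hx 1)
    have e : ∀ j, B (σ (A (x j)) • x j 0) (x j 1) = |A (x j)| := by
      intro j
      rw [h2, map_smul, LinearMap.smul_apply, hBA, smul_eq_mul]
      congr 2
      ext i; fin_cases i <;> rfl
    simp only [e] at this
    have h3 := (le_abs_self _).trans this
    have := norm_nonneg A
    norm_num
    linarith
  | succ k ih =>
    have key := aux_improve {v : ℝ | ∃ (x : Fin N → Fin (k + 1 + 2) → Fin n → ℝ),
      (∀ i p, ∑ j, x j i p ^ 2 ≤ 1) ∧ v = ∑ j, |A (x j)|}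
      (N * ‖A‖) (7 * (10 ^ (k + 2) * ‖A‖)) (1 / 4) (10 ^ (k + 1 + 2) * ‖A‖) (by norm_num) ?_ ?_ ?_
    · exact key _ ⟨x, hx, rfl⟩
    · rintro v ⟨x, hx, rfl⟩
      have : ∀ j ∈ (Finset.univ : Finset (Fin N)), |A (x j)| ≤ ‖A‖ := by
        intro j _
        refine (A.le_opNorm (x j)).trans ?_
        refine mul_le_of_le_one_right (norm_nonneg _) ?_
        exact Finset.prod_le_one (fun _ _ => norm_nonneg _)
          (fun i _ => aux_coord (fun j => x j i) (hx i) j)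
      refine (Finset.sum_le_sum this).trans ?_
      simp
    · rintro K hK v ⟨x, hx, rfl⟩
      obtain ⟨L, hL, r, h1, h0, h2, hs⟩ := aux_split N
      obtain ⟨Xb, Xt, X1, X2, X3, X4, X5, X6⟩ := hs n (fun j => x j 0) (hx 0)
      have hL' : (0 : ℝ) < L := by exact_mod_cast hL
      set w : Fin N → Fin n → ℝ := fun j => (L : ℝ)⁻¹ • ∑ s, r j s • (4 : ℝ) • Xt s with hw
      have hwp : ∀ p, ∑ j, w j p ^ 2 ≤ 1 := by
        intro p
        have hwj : ∀ j, L * w j p = ∑ s, r j s * (4 * Xt s p) := by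
          intro j; simp [hw, ← mul_assoc, hL'.ne']
        have e1 := h2 (fun j => w j p)
        have e2 : ∑ s, (4 * Xt s p) * (∑ j, r j s * w j p) = L * ∑ j, w j p ^ 2 := by
          simp only [Finset.mul_sum]
          rw [Finset.sum_comm]
          refine Finset.sum_congr rfl fun j _ => ?_
          rw [sq, ← mul_assoc, hwj, Finset.sum_mul]
          refine Finset.sum_congr rfl fun s _ => by ring
        have e3 : 0 ≤ ∑ s, (4 * Xt s p - ∑ j, r j s * w j p) ^ 2 :=
          Finset.sum_nonneg fun _ _ => sq_nonneg _
        have e4 : ∑ s, (4 * Xt s p - ∑ j, r j s * w j p) ^ 2 = ∑ s, (4 * Xt s p) ^ 2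
            - 2 * ∑ s, (4 * Xt s p) * (∑ j, r j s * w j p) + ∑ s, (∑ j, r j s * w j p) ^ 2 := by
          rw [Finset.mul_sum, ← Finset.sum_sub_distrib, ← Finset.sum_add_distrib]
          refine Finset.sum_congr rfl fun s _ => by ring
        have := X5 p
        have : L * ∑ j, w j p ^ 2 ≤ L * 1 := by linarith
        exact le_of_mul_le_mul_left this hL'
      have hA : ∀ j, |A (x j)| ≤ (L : ℝ)⁻¹ * ∑ s, |A.curryLeft (Xb s) (Fin.tail (x j))| +
          1 / 4 * |A (Fin.cons (w j) (Fin.tail (x j)))| := by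
        intro j
        have e : x j 0 = (L : ℝ)⁻¹ • ∑ s, r j s • Xb s + (1 / 4 : ℝ) • w j := by
          have : x j 0 = (L : ℝ)⁻¹ • ((L : ℝ) • x j 0) := by
            rw [smul_smul, inv_mul_cancel₀ hL'.ne', one_smul]
          rw [this, X6 j]
          simp only [hw, smul_add, Finset.sum_add_distrib]
          congr 1
          rw [smul_comm]
          congr 1
          rw [Finset.smul_sum]
          refine Finset.sum_congr rfl fun s _ => ?_
          rw [smul_comm, smul_smul (1 / 4 : ℝ)]; norm_num
        have e2 : A (x j) = A.curryLeft (x j 0) (Fin.tail (x j)) := by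
          rw [ContinuousMultilinearMap.curryLeft_apply, Fin.cons_self_tail]
        have e3 : A (x j) = (L : ℝ)⁻¹ * ∑ s, r j s * A.curryLeft (Xb s) (Fin.tail (x j)) +
            1 / 4 * A (Fin.cons (w j) (Fin.tail (x j))) := by
          rw [e2, e, ← ContinuousMultilinearMap.curryLeft_apply]
          simp only [map_add, map_smul, map_sum, _root_.add_apply,
            _root_.smul_apply, _root_.sum_apply, smul_eq_mul]
        rw [e3]
        refine (abs_add_le _ _).trans ?_
        rw [abs_mul, abs_mul, abs_of_pos (inv_pos.2 hL'), abs_of_pos (by norm_num : (0:ℝ) < 1/4)]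
        gcongr
        refine (Finset.abs_sum_le_sum_abs _ _).trans ?_
        refine Finset.sum_le_sum fun s _ => ?_
        rw [abs_mul]
        exact mul_le_of_le_one_left (abs_nonneg _) (h1 j s)
      refine (Finset.sum_le_sum fun j _ => hA j).trans ?_
      rw [Finset.sum_add_distrib, ← Finset.mul_sum, ← Finset.mul_sum, Finset.sum_comm]
      have hK' := hK _ ⟨fun j => Fin.cons (w j) (Fin.tail (x j)), by
        intro i p
        refine Fin.cases ?_ (fun i => ?_) i
        · simpa using hwp p
        · simpa [Fin.tail] using hx i.succ p, rfl⟩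
      have hI : ∀ s ∈ (Finset.univ : Finset (Fin L)),
          ∑ j, |A.curryLeft (Xb s) (Fin.tail (x j))| ≤ 7 * (10 ^ (k + 2) * ‖A‖) := by
        intro s _
        refine (ih (A.curryLeft (Xb s)) (fun j => Fin.tail (x j))
          (fun i p => hx i.succ p)).trans ?_
        have : ‖A.curryLeft (Xb s)‖ ≤ ‖A‖ * 7 := by
          refine (A.curryLeft.le_opNorm _).trans ?_
          rw [ContinuousMultilinearMap.curryLeft_norm]
          gcongr
          exact X2 s
        calc (10:ℝ) ^ (k + 2) * ‖A.curryLeft (Xb s)‖ ≤ 10 ^ (k + 2) * (‖A‖ * 7) := by gcongr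
          _ = _ := by ring
      have hI2 := Finset.sum_le_sum hI
      simp only [Finset.sum_const, Finset.card_univ, Fintype.card_fin, nsmul_eq_mul] at hI2
      have : (L : ℝ)⁻¹ * ∑ s, ∑ j, |A.curryLeft (Xb s) (Fin.tail (x j))| ≤
          7 * (10 ^ (k + 2) * ‖A‖) := by
        rw [inv_mul_le_iff₀ hL']; exact hI2
      linarith
    · have : 0 ≤ (10 : ℝ) ^ (k + 2) * ‖A‖ := by positivity
      have e : (10 : ℝ) ^ (k + 1 + 2) = 10 * 10 ^ (k + 2) := by ring
      rw [e]; linarith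

lemma aux_bddAbove {E : Type*} [NormedAddCommGroup E] [NormedSpace ℝ E]
    (q : ℝ) (hq : 0 < q) {k : ℕ} (x : Fin k → E) :
    BddAbove {s : ℝ | ∃ φ : E →L[ℝ] ℝ, ‖φ‖ ≤ 1 ∧ s = (∑ j, |φ (x j)| ^ q) ^ (1 / q)} := by
  refine ⟨(∑ j, ‖x j‖ ^ q) ^ (1 / q), ?_⟩
  rintro s ⟨φ, hφ, rfl⟩
  have : ∀ j, |φ (x j)| ≤ ‖x j‖ := fun j => by
    have := φ.le_of_opNorm_le hφ (x j)
    simpa using this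
  have h0 : 0 ≤ ∑ j, |φ (x j)| ^ q := Finset.sum_nonneg fun j _ => by positivity
  refine Real.rpow_le_rpow h0 ?_ (by positivity)
  refine Finset.sum_le_sum fun j _ => Real.rpow_le_rpow (abs_nonneg _) (this j) hq.le

lemma aux_weakNorm_nonneg {E : Type*} [NormedAddCommGroup E] [NormedSpace ℝ E]
    (q : ℝ) {k : ℕ} (x : Fin k → E) : 0 ≤ weakNorm q x := by
  refine Real.sSup_nonneg ?_
  rintro s ⟨φ, hφ, rfl⟩
  have h0 : 0 ≤ ∑ j, |φ (x j)| ^ q := Finset.sum_nonneg fun j _ => by positivity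
  positivity

lemma aux_weak2 {E : Type*} [NormedAddCommGroup E] [NormedSpace ℝ E]
    {k : ℕ} (x : Fin k → E) (φ : E →L[ℝ] ℝ) :
    ∑ j, φ (x j) ^ 2 ≤ (‖φ‖ * weakNorm 2 x) ^ 2 := by
  have main : ∀ φ : E →L[ℝ] ℝ, ‖φ‖ ≤ 1 → ∑ j, φ (x j) ^ 2 ≤ weakNorm 2 x ^ 2 := by
    intro φ hφ
    have h : _ ≤ weakNorm 2 x := le_csSup (aux_bddAbove 2 (by norm_num) x) ⟨φ, hφ, rfl⟩
    simp only [Real.rpow_two, sq_abs, ← Real.sqrt_eq_rpow] at h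
    exact (Real.sqrt_le_left (aux_weakNorm_nonneg _ _)).1 h
  by_cases h0 : ‖φ‖ = 0
  · have : φ = 0 := norm_eq_zero.1 h0
    simp [this]
  · have hpos : 0 < ‖φ‖ := lt_of_le_of_ne (norm_nonneg _) (Ne.symm h0)
    have := main (‖φ‖⁻¹ • φ) (by rw [norm_smul, norm_inv, norm_norm, inv_mul_cancel₀ h0])
    simp only [_root_.smul_apply, smul_eq_mul, mul_pow, ← Finset.mul_sum] at this
    rw [inv_pow, inv_mul_le_iff₀ (by positivity)] at this
    rw [mul_pow]; exact this

lemma aux_weak1 {E : Type*} [NormedAddCommGroup E] [NormedSpace ℝ E]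
    {k : ℕ} (x : Fin k → E) (φ : E →L[ℝ] ℝ) (hφ : ‖φ‖ ≤ 1) :
    ∑ j, |φ (x j)| ≤ weakNorm 1 x := by
  have h : _ ≤ weakNorm 1 x := le_csSup (aux_bddAbove 1 (by norm_num) x) ⟨φ, hφ, rfl⟩
  simpa using h

lemma aux_weak1_le {E : Type*} [NormedAddCommGroup E] [NormedSpace ℝ E]
    {k : ℕ} (x : Fin k → E) (M : ℝ)
    (h : ∀ φ : E →L[ℝ] ℝ, ‖φ‖ ≤ 1 → ∑ j, |φ (x j)| ≤ M) : weakNorm 1 x ≤ M := by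
  refine csSup_le ⟨_, 0, by simp, rfl⟩ ?_
  rintro s ⟨φ, hφ, rfl⟩
  simpa using h φ hφ

lemma aux_norm_le {E : Type*} [NormedAddCommGroup E] [NormedSpace ℝ E]
    {k : ℕ} (x : Fin k → E) (j : Fin k) : ‖x j‖ ≤ weakNorm 2 x := by
  obtain ⟨φ, hφ, he⟩ := exists_dual_vector'' ℝ (x j)
  have h1 := aux_weak2 x φ
  have h2 := Finset.single_le_sum (f := fun j => φ (x j) ^ 2) (fun _ _ => sq_nonneg _)
    (Finset.mem_univ j)
  have hw := aux_weakNorm_nonneg 2 x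
  have h3 : ‖φ‖ * weakNorm 2 x ≤ weakNorm 2 x := mul_le_of_le_one_left hw hφ
  have h4 : (‖φ‖ * weakNorm 2 x) ^ 2 ≤ weakNorm 2 x ^ 2 :=
    pow_le_pow_left₀ (by positivity) h3 2
  have h5 : φ (x j) = ‖x j‖ := by simpa using he
  simp only [h5] at h2
  exact (sq_le_sq₀ (norm_nonneg _) hw).1 (by linarith)

lemma aux_rad_le {F : Type*} [NormedAddCommGroup F] [NormedSpace ℝ F]
    {k : ℕ} (y : Fin k → F) : radNorm y ≤ weakNorm 1 y := by
  have hW := aux_weakNorm_nonneg 1 y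
  have hpt : ∀ t, ‖∑ j : Fin k, rademacher (j : ℕ) t • y j‖ ≤ weakNorm 1 y := by
    intro t
    obtain ⟨φ, hφ, he⟩ := exists_dual_vector'' ℝ (∑ j : Fin k, rademacher (j : ℕ) t • y j)
    have he' : φ (∑ j : Fin k, rademacher (j : ℕ) t • y j) =
      ‖∑ j : Fin k, rademacher (j : ℕ) t • y j‖ := by simpa using he
    rw [← he', map_sum]
    refine le_trans ?_ (aux_weak1 y φ hφ)
    refine Finset.sum_le_sum fun j _ => ?_
    rw [map_smul, smul_eq_mul]
    unfold rademacher
    split_ifs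
    · simpa using le_abs_self _
    · simpa using neg_le_abs _
  have hint := intervalIntegral.norm_integral_le_of_norm_le_const (a := (0:ℝ)) (b := 1)
    (f := fun t => ‖∑ j : Fin k, rademacher (j : ℕ) t • y j‖ ^ 2) (C := weakNorm 1 y ^ 2)
    (fun t _ => by
      rw [Real.norm_of_nonneg (by positivity)]
      exact pow_le_pow_left₀ (norm_nonneg _) (hpt t) 2)
  unfold radNorm
  rw [← Real.sqrt_eq_rpow]
  refine (Real.sqrt_le_left hW).2 ?_
  refine (Real.le_norm_self _).trans (hint.trans (by simp))

lemma aux_multi_scaled {n : ℕ} (k : ℕ)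
    (A : ContinuousMultilinearMap ℝ (fun _ : Fin (k + 2) => Fin n → ℝ) ℝ)
    (N : ℕ) (y : Fin N → Fin n → ℝ) (τ : ℝ) (hτ : 0 ≤ τ) (hy : ∀ p, ∑ j, y j p ^ 2 ≤ τ ^ 2) :
    ∑ j, |A (fun _ => y j)| ≤ 10 ^ (k + 2) * ‖A‖ * τ ^ (k + 2) := by
  rcases hτ.eq_or_lt with h | h
  · subst h
    have hz : ∀ j, y j = 0 := by
      intro j; ext p
      have h1 := (Finset.single_le_sum (f := fun j => y j p ^ 2) (fun _ _ => sq_nonneg _)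
        (Finset.mem_univ j)).trans (hy p)
      have h2 : y j p ^ 2 ≤ 0 := by simpa using h1
      exact pow_eq_zero_iff (two_ne_zero) |>.1 (le_antisymm h2 (sq_nonneg _))
    have : ∀ j, A (fun _ => y j) = 0 := fun j => A.map_coord_zero 0 (hz j)
    simp [this]
  · have := aux_multi k A N (fun j _ => τ⁻¹ • y j) (by
      intro _ p
      simp only [Pi.smul_apply, smul_eq_mul, mul_pow, ← Finset.mul_sum]
      rw [inv_pow, inv_mul_le_iff₀ (by positivity)]
      simpa using hy p)
    have e : ∀ j, |A (fun _ => τ⁻¹ • y j)| = (τ ^ (k + 2))⁻¹ * |A (fun _ => y j)| := by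
      intro j
      have := A.map_smul_univ (fun _ => τ⁻¹) (fun _ => y j)
      rw [this]
      simp [abs_mul, abs_of_pos h]
    simp only [e, ← Finset.mul_sum] at this
    rw [inv_mul_le_iff₀ (by positivity)] at this
    linarith

lemma aux_perez {E : Type*} [NormedAddCommGroup E] [NormedSpace ℝ E]
    (lam : ℝ) (hE : IsLinftySpace lam E) (k : ℕ)
    (A : ContinuousMultilinearMap ℝ (fun _ : Fin (k + 2) => E) ℝ) (N : ℕ) (x : Fin N → E) :
    ∑ j, |A (fun _ => x j)| ≤ ‖A‖ * (10 * lam * weakNorm 2 x) ^ (k + 2) := by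
  obtain ⟨H, hGH, hH, n, e, he⟩ := hE (Submodule.span ℝ (Set.range x))
    (FiniteDimensional.span_of_finite ℝ (Set.finite_range x))
  have hw := aux_weakNorm_nonneg 2 x
  have hxH : ∀ j, x j ∈ H := fun j => hGH (Submodule.subset_span ⟨j, rfl⟩)
  set y : Fin N → Fin n → ℝ := fun j => e ⟨x j, hxH j⟩ with hy
  set f : (Fin n → ℝ) →L[ℝ] E := H.subtypeL.comp (e.symm : (Fin n → ℝ) →L[ℝ] H) with hf
  have hfy : ∀ j, f (y j) = x j := by intro j; simp [hf, hy]
  have hfn : ‖f‖ ≤ ‖(e.symm : (Fin n → ℝ) →L[ℝ] H)‖ := by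
    refine ContinuousLinearMap.opNorm_le_bound _ (ContinuousLinearMap.opNorm_nonneg _) fun v => ?_
    exact (e.symm : (Fin n → ℝ) →L[ℝ] H).le_opNorm v
  have hyp : ∀ p, ∑ j, y j p ^ 2 ≤ (‖(e : H →L[ℝ] (Fin n → ℝ))‖ * weakNorm 2 x) ^ 2 := by
    intro p
    set ψ : H →L[ℝ] ℝ := (ContinuousLinearMap.proj p).comp (e : H →L[ℝ] (Fin n → ℝ)) with hψ
    have hψn : ‖ψ‖ ≤ ‖(e : H →L[ℝ] (Fin n → ℝ))‖ := by
      refine ContinuousLinearMap.opNorm_le_bound _ (ContinuousLinearMap.opNorm_nonneg _) fun v => ?_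
      exact (norm_le_pi_norm (e v) p).trans ((e : H →L[ℝ] (Fin n → ℝ)).le_opNorm v)
    obtain ⟨φ, h1, h2⟩ := exists_extension_norm_eq H ψ
    have h3 := aux_weak2 x φ
    have h4 : ∀ j, φ (x j) = y j p := fun j => h1 ⟨x j, hxH j⟩
    simp only [h4] at h3
    refine h3.trans ?_
    rw [h2]
    gcongr
  have hm := aux_multi_scaled k (A.compContinuousLinearMap (fun _ => f)) N y _ (by positivity) hyp
  have e1 : ∀ j, (A.compContinuousLinearMap (fun _ => f)) (fun _ => y j) = A (fun _ => x j) := by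
    intro j; simp [hfy]
  simp only [e1] at hm
  refine hm.trans ?_
  have hn := A.norm_compContinuousLinearMap_le (fun _ => f)
  simp only [Finset.prod_const, Finset.card_univ, Fintype.card_fin] at hn
  have hn2 : ‖f‖ ^ (k + 2) ≤ ‖(e.symm : (Fin n → ℝ) →L[ℝ] H)‖ ^ (k + 2) := by gcongr
  calc _ ≤ 10 ^ (k + 2) * (‖A‖ * ‖(e.symm : (Fin n → ℝ) →L[ℝ] H)‖ ^ (k + 2)) *
        (‖(e : H →L[ℝ] (Fin n → ℝ))‖ * weakNorm 2 x) ^ (k + 2) := by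
        gcongr
        exact hn.trans (by gcongr)
    _ = ‖A‖ * (10 * (‖(e : H →L[ℝ] (Fin n → ℝ))‖ * ‖(e.symm : (Fin n → ℝ) →L[ℝ] H)‖) *
        weakNorm 2 x) ^ (k + 2) := by
        simp only [mul_pow]; ring
    _ ≤ _ := by gcongr

lemma aux_main {E F : Type*} [NormedAddCommGroup E] [NormedSpace ℝ E]
    [NormedAddCommGroup F] [NormedSpace ℝ F]
    (lam : ℝ) (hlam : 1 ≤ lam) (hE : IsLinftySpace lam E)
    (g : E → F) (a : E) (hg : AnalyticAt ℝ g a) (hdg : fderiv ℝ g a = 0) :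
      ∃ D > (0:ℝ), ∃ δ > (0:ℝ), ∀ (m : ℕ) (x : Fin m → E), weakNorm 2 x < δ →
        weakNorm 1 (fun j => g (a + x j) - g a) ≤ D * weakNorm 2 x := by
  obtain ⟨p, r, hp⟩ := hg
  have hfd : continuousMultilinearCurryFin1 ℝ E F (p 1) = 0 := by
    rw [← hdg]; exact hp.hasFPowerSeriesAt.hasFDerivAt.fderiv.symm
  have hp1 : ∀ v : E, p 1 (fun _ => v) = 0 := by
    intro v
    have := congrArg (fun T : E →L[ℝ] F => T v) hfd
    simp only [continuousMultilinearCurryFin1_apply] at this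
    refine Eq.trans ?_ this
    congr 1
  have hp0 : ∀ v : Fin 0 → E, p 0 v = g a := hp.coeff_zero
  obtain ⟨C, c, hC, hc, hpn⟩ := p.le_mul_pow_of_radius_pos (hp.r_pos.trans_le hp.r_le)
  obtain ⟨ρ, hρ0, hρ⟩ := ENNReal.lt_iff_exists_nnreal_btwn.1 hp.r_pos
  have hρpos : (0 : ℝ) < ρ := by exact_mod_cast hρ0
  set q := 10 * lam * c with hq
  have hqpos : 0 < q := by positivity
  refine ⟨C * q, by positivity, min ρ (1 / (2 * q)), by positivity, fun m x hx => ?_⟩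
  set w := weakNorm 2 x with hwdef
  have hw : 0 ≤ w := aux_weakNorm_nonneg 2 x
  have hwρ : w < ρ := hx.trans_le (min_le_left _ _)
  have hwq : q * w ≤ 1 / 2 := by
    have := (hx.trans_le (min_le_right _ _)).le
    rw [le_div_iff₀ (by positivity)] at this
    linarith
  have hqw : 0 ≤ q * w := by positivity
  refine aux_weak1_le _ _ fun φ hφ => ?_
  have hs : ∀ j, HasSum (fun n => φ (p (n + 2) (fun _ => x j))) (φ (g (a + x j) - g a)) := by
    intro j
    have hmem : x j ∈ Metric.eball (0 : E) r := by
      have h1 : ‖x j‖ < ρ := (aux_norm_le x j).trans_lt hwρ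
      rw [Metric.mem_eball, edist_zero_right]
      refine lt_trans ?_ hρ
      rw [enorm_eq_nnnorm]
      exact_mod_cast h1
    have h1 := hp.hasSum hmem
    have h2 := (hasSum_nat_add_iff' 2).2 h1
    simp only [Finset.sum_range_succ, Finset.sum_range_zero, zero_add, hp0, hp1, add_zero] at h2
    exact h2.mapL φ
  have htend : Tendsto (fun M => ∑ j, |∑ n ∈ Finset.range M, φ (p (n + 2) (fun _ => x j))|) atTop
      (nhds (∑ j, |φ (g (a + x j) - g a)|)) :=
    tendsto_finsetSum _ fun j _ => (hs j).tendsto_sum_nat.abs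
  refine le_of_tendsto' htend fun M => ?_
  have hterm : ∀ n, ∑ j, |φ (p (n + 2) (fun _ => x j))| ≤ C * (q * w) ^ 2 * (q * w) ^ n := by
    intro n
    have h1 := aux_perez lam hE n (φ.compContinuousMultilinearMap (p (n + 2))) m x
    have h2 := φ.norm_compContinuousMultilinearMap_le (p (n + 2))
    have h3 : ‖φ.compContinuousMultilinearMap (p (n + 2))‖ ≤ C * c ^ (n + 2) :=
      h2.trans ((mul_le_of_le_one_left (norm_nonneg _) hφ).trans (hpn _))
    refine h1.trans ?_
    calc _ ≤ C * c ^ (n + 2) * (10 * lam * w) ^ (n + 2) := by gcongr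
      _ = _ := by rw [hq]; ring
  calc ∑ j, |∑ n ∈ Finset.range M, φ (p (n + 2) (fun _ => x j))|
      ≤ ∑ j, ∑ n ∈ Finset.range M, |φ (p (n + 2) (fun _ => x j))| :=
        Finset.sum_le_sum fun j _ => Finset.abs_sum_le_sum_abs _ _
    _ = ∑ n ∈ Finset.range M, ∑ j, |φ (p (n + 2) (fun _ => x j))| := Finset.sum_comm
    _ ≤ ∑ n ∈ Finset.range M, C * (q * w) ^ 2 * (q * w) ^ n := Finset.sum_le_sum fun n _ => hterm n
    _ = C * (q * w) ^ 2 * ∑ n ∈ Finset.range M, (q * w) ^ n := by rw [Finset.mul_sum]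
    _ ≤ C * (q * w) ^ 2 * 2 := by
        gcongr
        refine (Finset.sum_le_sum fun n _ => pow_le_pow_left₀ hqw hwq n).trans ?_
        exact sum_geometric_two_le M
    _ ≤ C * q * w := by
        have : (q * w) ^ 2 * 2 ≤ q * w := by nlinarith
        calc C * (q * w) ^ 2 * 2 = C * ((q * w) ^ 2 * 2) := by ring
          _ ≤ C * (q * w) := by gcongr
          _ = _ := by ring

theorem stmt16 {E F : Type*} [NormedAddCommGroup E] [NormedSpace ℝ E]
    [NormedAddCommGroup F] [NormedSpace ℝ F]
    (lam : ℝ) (hlam : 1 ≤ lam) (hE : IsLinftySpace lam E)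
    (g : E → F) (a : E) (hg : AnalyticAt ℝ g a) (hdg : fderiv ℝ g a = 0) :
    AlmostSummingAt 2 g a ∧
      ∃ D > (0:ℝ), ∃ δ > (0:ℝ), ∀ (m : ℕ) (x : Fin m → E), weakNorm 2 x < δ →
        weakNorm 1 (fun j => g (a + x j) - g a) ≤ D * weakNorm 2 x := by
  obtain ⟨D, hD, δ, hδ, h⟩ := aux_main lam hlam hE g a hg hdg
  refine ⟨⟨D, hD, δ, hδ, 1, one_pos, fun k x hx => ?_⟩, D, hD, δ, hδ, h⟩
  have := (aux_rad_le _).trans (h k x hx)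
  simpa using this
end

section
/- For n ≥ 2, every continuous n-homogeneous polynomial P : c_0 → c_0 is almost 2-summing at 0, but there exists a continuous n-homogeneous polynomial P : c_0 → c_0 which is not almost 2-summing at every point of c_0. -/
open MeasureTheory Filter Finset

/-! ### Finite-dimensional multilinear Grothendieck inequality via Riesz products -/

/-- A sign from a boolean. -/
noncomputable def sgnB (b : Bool) : ℝ := if b then 1 else -1

theorem sgnB_sq (b : Bool) : sgnB b * sgnB b = 1 := by cases b <;> simp [sgnB]

theorem chi_orth {J : Type} [Fintype J] [DecidableEq J] (S R : Finset J) :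
    ∑ w : J → Bool, (∏ j ∈ S, sgnB (w j)) * (∏ j ∈ R, sgnB (w j))
      = if S = R then (2 : ℝ) ^ Fintype.card J else 0 := by
  have h1 : ∀ w : J → Bool, (∏ j ∈ S, sgnB (w j)) * (∏ j ∈ R, sgnB (w j))
      = ∏ j, ((if j ∈ S then sgnB (w j) else 1) * (if j ∈ R then sgnB (w j) else 1)) := by
    intro w
    rw [Finset.prod_mul_distrib, Finset.prod_ite_mem, Finset.prod_ite_mem]
    simp
  simp_rw [h1]
  rw [← Fintype.prod_sum (fun (j : J) (b : Bool) =>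
    (if j ∈ S then sgnB b else 1) * (if j ∈ R then sgnB b else 1))]
  split_ifs with h
  · subst h
    rw [Finset.prod_congr rfl (g := fun _ => (2 : ℝ))]
    · simp
    · intro j _
      by_cases hj : j ∈ S <;> simp [hj, sgnB]
      all_goals norm_num
  · have : ∃ j, ¬ (j ∈ S ↔ j ∈ R) := by
      by_contra hc
      push Not at hc
      exact h (Finset.ext hc)
    obtain ⟨j, hj⟩ := this
    apply Finset.prod_eq_zero (Finset.mem_univ j)
    by_cases h1 : j ∈ S <;> by_cases h2 : j ∈ R <;> simp_all [sgnB]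

/-- Characters whose product over all levels is one. -/
noncomputable def sgnL {J : Type} {N : ℕ} (ω : Fin N → J → Bool) : Fin (N + 1) → J → ℝ :=
  Fin.cons (fun j => ∏ l, sgnB (ω l j)) (fun l j => sgnB (ω l j))

theorem sgnL_sq {J : Type} {N : ℕ} (ω : Fin N → J → Bool) (l : Fin (N + 1)) (j : J) :
    sgnL ω l j * sgnL ω l j = 1 := by
  refine Fin.cases ?_ (fun i => ?_) l
  · simp [sgnL, ← Finset.prod_mul_distrib, sgnB_sq]
  · simp [sgnL, sgnB_sq]

theorem sgnL_orth {J : Type} [Fintype J] [DecidableEq J] {N : ℕ} (r : Fin (N + 1) → Finset J) :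
    ∑ ω : Fin N → J → Bool, ∏ l, ∏ j ∈ r l, sgnL ω l j
      = if r = (fun _ => r 0) then ((2 : ℝ) ^ Fintype.card J) ^ N else 0 := by
  have h1 : ∀ ω : Fin N → J → Bool, ∏ l, ∏ j ∈ r l, sgnL ω l j
      = ∏ l : Fin N, ((∏ j ∈ r 0, sgnB (ω l j)) * ∏ j ∈ r l.succ, sgnB (ω l j)) := by
    intro ω
    rw [Fin.prod_univ_succ, Finset.prod_mul_distrib]
    simp only [sgnL, Fin.cons_zero, Fin.cons_succ]
    rw [Finset.prod_comm]
  simp_rw [h1]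
  rw [← Fintype.prod_sum (fun (l : Fin N) (w : J → Bool) =>
    (∏ j ∈ r 0, sgnB (w j)) * ∏ j ∈ r l.succ, sgnB (w j))]
  simp_rw [chi_orth]
  split_ifs with h
  · rw [Finset.prod_congr rfl (g := fun _ => (2 : ℝ) ^ Fintype.card J)]
    · simp
    · intro l _
      rw [if_pos]
      rw [h]
  · have : ∃ l : Fin N, r 0 ≠ r l.succ := by
      by_contra hc
      push Not at hc
      apply h
      funext l
      refine Fin.cases rfl (fun i => (hc i).symm) l
    obtain ⟨l, hl⟩ := this
    exact Finset.prod_eq_zero (Finset.mem_univ l) (if_neg hl)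

/-- Coefficients of the imaginary part of the Riesz product. -/
noncomputable def rc {J : Type} (S : Finset J) : ℝ := (Complex.I ^ S.card).im

theorem rc_abs {J : Type} (S : Finset J) : |rc S| ≤ 1 := by
  refine (Complex.abs_im_le_norm _).trans ?_
  simp

theorem riesz_bound {J : Type} [Fintype J] [DecidableEq J] (u e : J → ℝ)
    (hu : ∑ j, u j ^ 2 ≤ 1) (he : ∀ j, e j * e j = 1) :
    |∑ S : Finset J, rc S * ∏ j ∈ S, (e j * u j)| ≤ 2 := by
  have h1 : ∑ S : Finset J, rc S * ∏ j ∈ S, (e j * u j)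
      = (∏ j, (1 + Complex.I * ((e j * u j : ℝ) : ℂ))).im := by
    rw [Finset.prod_one_add, Finset.powerset_univ, Complex.im_sum]
    refine Finset.sum_congr rfl fun S _ => ?_
    rw [Finset.prod_mul_distrib (f := fun _ => Complex.I), Finset.prod_const, ← Complex.ofReal_prod, Complex.im_mul_ofReal]
    rfl
  rw [h1]
  refine (Complex.abs_im_le_norm _).trans ?_
  have h2 : ‖∏ j, (1 + Complex.I * ((e j * u j : ℝ) : ℂ))‖ ^ 2 ≤ 4 := by
    rw [norm_prod, ← Finset.prod_pow]
    calc ∏ j, ‖1 + Complex.I * ((e j * u j : ℝ) : ℂ)‖ ^ 2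
        ≤ ∏ j, Real.exp (u j ^ 2) := by
          refine Finset.prod_le_prod (fun _ _ => by positivity) fun j _ => ?_
          rw [← Complex.normSq_eq_norm_sq, Complex.normSq_apply]
          have := Real.add_one_le_exp (u j ^ 2)
          have h3 := he j
          simp
          nlinarith [mul_mul_mul_comm (e j) (u j) (e j) (u j)]
      _ = Real.exp (∑ j, u j ^ 2) := (Real.exp_sum _ _).symm
      _ ≤ Real.exp 1 := Real.exp_le_exp.2 hu
      _ ≤ 4 := by linarith [Real.exp_one_lt_d9]
  nlinarith [norm_nonneg (∏ j, (1 + Complex.I * ((e j * u j : ℝ) : ℂ)))]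

/-- Coefficients of the error term. -/
noncomputable def rc' {J : Type} (S : Finset J) : ℝ := if S.card = 1 then 0 else rc S

theorem err_bound {J : Type} [Fintype J] [DecidableEq J] (u : J → ℝ)
    (hu : ∑ j, u j ^ 2 ≤ 1) :
    ∑ S : Finset J, (rc' S * ∏ j ∈ S, u j) ^ 2 ≤ 49 / 64 := by
  set σ := ∑ j, u j ^ 2 with hσ
  have h1 : ∑ S : Finset J, ∏ j ∈ S, u j ^ 2 ≤ Real.exp σ := by
    have := Finset.prod_one_add (f := fun j => u j ^ 2) (Finset.univ : Finset J)
    rw [Finset.powerset_univ] at this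
    rw [← this, hσ, Real.exp_sum]
    refine Finset.prod_le_prod (fun _ _ => by positivity) fun j _ => ?_
    linarith [Real.add_one_le_exp (u j ^ 2)]
  have hsing : ∑ S : Finset J, (if S.card = 1 then ∏ j ∈ S, u j ^ 2 else 0) = σ := by
    rw [← Finset.sum_filter]
    have : (Finset.univ.filter fun S : Finset J => S.card = 1)
        = Finset.univ.image (fun j : J => ({j} : Finset J)) := by
      ext S
      simp [Finset.card_eq_one, eq_comm]
    rw [this, Finset.sum_image (by intro a _ b _ h; simpa using h)]
    simp [hσ]
  have hemp : ∑ S : Finset J, (if S = ∅ then (1 : ℝ) else 0) = 1 := by simp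
  have h2 : ∑ S : Finset J, (rc' S * ∏ j ∈ S, u j) ^ 2 ≤ ∑ S : Finset J,
      (∏ j ∈ S, u j ^ 2 - (if S.card = 1 then ∏ j ∈ S, u j ^ 2 else 0)
        - (if S = ∅ then (1 : ℝ) else 0)) := by
    refine Finset.sum_le_sum fun S _ => ?_
    rw [mul_pow, ← Finset.prod_pow]
    by_cases h0 : S = ∅
    · subst h0; simp [rc', rc]
    by_cases h1 : S.card = 1
    · simp [h1, rc', h0]
    · simp only [rc', h1, h0, if_false, sub_zero]
      have h3 : rc S ^ 2 ≤ 1 := (sq_le_one_iff_abs_le_one _).2 (rc_abs S)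
      have h4 : 0 ≤ ∏ j ∈ S, u j ^ 2 := Finset.prod_nonneg fun _ _ => by positivity
      nlinarith
  rw [Finset.sum_sub_distrib, Finset.sum_sub_distrib, hsing, hemp] at h2
  have hσ0 : 0 ≤ σ := Finset.sum_nonneg fun _ _ => by positivity
  have h5 : Real.exp σ - σ ≤ Real.exp 1 - 1 := by
    have e1 : Real.exp 1 = Real.exp σ * Real.exp (1 - σ) := by rw [← Real.exp_add]; ring_nf
    have e2 := Real.add_one_le_exp (1 - σ)
    have e3 := Real.one_le_exp hσ0
    rw [e1]
    nlinarith
  linarith [Real.exp_one_lt_d9]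

/-- The bound `B` holds for all weakly `2`-summable families in the unit ball. -/
def GBound {ι : Type} {N : ℕ}
    (T : MultilinearMap ℝ (fun _ : Fin (N + 1) => ι → ℝ) ℝ) (B : ℝ) : Prop :=
  ∀ (J : Type) (_ : Fintype J) (x : Fin (N + 1) → J → ι → ℝ),
    (∀ l p, ∑ j, x l j p ^ 2 ≤ 1) → |∑ j, T (fun l => x l j)| ≤ B

theorem gbound_step {ι : Type} [Fintype ι] {N : ℕ}
    (T : MultilinearMap ℝ (fun _ : Fin (N + 1) => ι → ℝ) ℝ) (M B : ℝ) (hM : 0 ≤ M)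
    (hT : ∀ v, |T v| ≤ M * ∏ l, ‖v l‖) (hB : GBound T B) :
    GBound T (M * 2 ^ (N + 1) + 7 / 8 * B) := by
  classical
  intro J _ x hx
  set y : Fin (N + 1) → Finset J → ι → ℝ := fun l S => rc S • ∏ j ∈ S, x l j with hy
  set y' : Fin (N + 1) → Finset J → ι → ℝ := fun l S => rc' S • ∏ j ∈ S, x l j with hy'
  have hB0 : 0 ≤ B := by
    have := hB PEmpty inferInstance (fun _ j => j.elim) (by simp)
    simpa using this
  -- the Riesz averages
  have hΦ : ∀ ω : Fin N → J → Bool,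
      |T (fun l => ∑ S, (∏ j ∈ S, sgnL ω l j) • y l S)| ≤ M * 2 ^ (N + 1) := by
    intro ω
    refine (hT _).trans ?_
    refine mul_le_mul_of_nonneg_left ?_ hM
    calc _ ≤ ∏ l : Fin (N + 1), (2 : ℝ) := by
          refine Finset.prod_le_prod (fun _ _ => norm_nonneg _) fun l _ => ?_
          rw [pi_norm_le_iff_of_nonneg (by norm_num)]
          intro p
          rw [Real.norm_eq_abs]
          have := riesz_bound (fun j => x l j p) (sgnL ω l) (hx l p) (sgnL_sq ω l)
          refine le_of_eq_of_le ?_ this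
          congr 1
          rw [Finset.sum_apply]
          refine Finset.sum_congr rfl fun S _ => ?_
          simp only [hy, Pi.smul_apply, smul_eq_mul, Finset.prod_apply, Finset.prod_mul_distrib]
          ring
      _ = _ := by simp
  have hexp : ∑ ω : Fin N → J → Bool, T (fun l => ∑ S, (∏ j ∈ S, sgnL ω l j) • y l S)
      = ((2 : ℝ) ^ Fintype.card J) ^ N * ∑ S, T (fun l => y l S) := by
    have : ∀ ω : Fin N → J → Bool, T (fun l => ∑ S, (∏ j ∈ S, sgnL ω l j) • y l S)
        = ∑ r : Fin (N + 1) → Finset J,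
          (∏ l, ∏ j ∈ r l, sgnL ω l j) * T (fun l => y l (r l)) := by
      intro ω
      rw [MultilinearMap.map_sum]
      refine Finset.sum_congr rfl fun r _ => ?_
      rw [T.map_smul_univ (fun l => ∏ j ∈ r l, sgnL ω l j) (fun l => y l (r l)), smul_eq_mul]
    simp_rw [this]
    rw [Finset.sum_comm]
    simp_rw [← Finset.sum_mul, sgnL_orth, ite_mul, zero_mul]
    rw [← Finset.sum_filter, Finset.mul_sum]
    symm
    refine Finset.sum_bij (fun S _ => fun _ => S) ?_ ?_ ?_ ?_
    · intro S _; simp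
    · intro S _ R _ h; exact congrFun h 0
    · intro r hr
      simp only [Finset.mem_filter, Finset.mem_univ, true_and] at hr
      exact ⟨r 0, Finset.mem_univ _, hr.symm⟩
    · intro S _; rfl
  have hmain : |∑ S, T (fun l => y l S)| ≤ M * 2 ^ (N + 1) := by
    have hpos : (0 : ℝ) < ((2 : ℝ) ^ Fintype.card J) ^ N := by positivity
    have h := (Finset.abs_sum_le_sum_abs _ _).trans
      (Finset.sum_le_sum fun ω (_ : ω ∈ Finset.univ) => hΦ ω)
    rw [hexp, abs_mul, abs_of_pos hpos] at h
    simp only [Finset.sum_const, Finset.card_univ, Fintype.card_fun, Fintype.card_bool,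
      Fintype.card_fin, nsmul_eq_mul] at h
    push_cast at h
    exact le_of_mul_le_mul_left h hpos
  -- splitting
  have hsplit : ∑ S, T (fun l => y l S) = ∑ j, T (fun l => x l j) + ∑ S, T (fun l => y' l S) := by
    have h1 : ∀ S : Finset J, T (fun l => y l S)
        = (if S.card = 1 then T (fun l => y l S) else 0) + T (fun l => y' l S) := by
      intro S
      by_cases h : S.card = 1
      · have : T (fun l => y' l S) = 0 := T.map_coord_zero 0 (by simp [hy', rc', h])
        rw [this]; simp [h]
      · simp [h, hy, hy', rc']
    rw [Finset.sum_congr rfl fun S _ => h1 S, Finset.sum_add_distrib]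
    congr 1
    rw [← Finset.sum_filter]
    have : (Finset.univ.filter fun S : Finset J => S.card = 1)
        = Finset.univ.image (fun j : J => ({j} : Finset J)) := by
      ext S
      simp [Finset.card_eq_one, eq_comm]
    rw [this, Finset.sum_image (by intro a _ b _ h; simpa using h)]
    simp [hy, rc]
  have herr : |∑ S, T (fun l => y' l S)| ≤ 7 / 8 * B := by
    have h := hB (Finset J) inferInstance (fun l S => (8 / 7 : ℝ) • y' l S) (by
      intro l p
      have := err_bound (fun j => x l j p) (hx l p)
      have h2 : ∑ S, ((8 / 7 : ℝ) • y' l S) p ^ 2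
          = 64 / 49 * ∑ S : Finset J, (rc' S * ∏ j ∈ S, x l j p) ^ 2 := by
        rw [Finset.mul_sum]
        refine Finset.sum_congr rfl fun S _ => ?_
        simp only [hy', Pi.smul_apply, smul_eq_mul, Finset.prod_apply]
        ring
      rw [h2]
      linarith)
    simp_rw [fun S => T.map_smul_univ (fun _ => (8 / 7 : ℝ)) (fun l => y' l S)] at h
    rw [← Finset.smul_sum, smul_eq_mul, abs_mul] at h
    simp only [Finset.prod_const, Finset.card_univ, Fintype.card_fin] at h
    rw [abs_of_pos (by positivity : (0 : ℝ) < (8 / 7) ^ (N + 1))] at h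
    have h3 : (8 / 7 : ℝ) ≤ (8 / 7) ^ (N + 1) := le_self_pow₀ (by norm_num) (by simp)
    have h4 := mul_le_mul_of_nonneg_right h3 (abs_nonneg (∑ S, T (fun l => y' l S)))
    linarith
  have : ∑ j, T (fun l => x l j) = ∑ S, T (fun l => y l S) - ∑ S, T (fun l => y' l S) := by
    rw [hsplit]; ring
  rw [this]
  exact (abs_sub _ _).trans (add_le_add hmain herr)

theorem sum_prod_le {J : Type} [Fintype J] {N : ℕ} (hN : 1 ≤ N) (u : Fin (N + 1) → J → ℝ)
    (hu : ∀ l, ∑ j, u l j ^ 2 ≤ 1) : ∑ j, |∏ l, u l j| ≤ 1 := by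
  obtain ⟨m, rfl⟩ : ∃ m, N = m + 1 := ⟨N - 1, by omega⟩
  have hle : ∀ l j, |u l j| ≤ 1 := by
    intro l j
    rw [← sq_le_one_iff_abs_le_one]
    exact (Finset.single_le_sum (f := fun j => u l j ^ 2) (fun _ _ => by positivity)
      (Finset.mem_univ j)).trans (hu l)
  have h : ∀ j, |∏ l, u l j| ≤ (u 0 j ^ 2 + u 1 j ^ 2) / 2 := by
    intro j
    rw [Fin.prod_univ_succ, Fin.prod_univ_succ, abs_mul, abs_mul]
    have h1 : |∏ i : Fin m, u i.succ.succ j| ≤ 1 := by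
      rw [Finset.abs_prod]
      exact Finset.prod_le_one (fun _ _ => abs_nonneg _) fun _ _ => hle _ _
    have h2 : |u (Fin.succ 0) j| * |∏ i : Fin m, u i.succ.succ j| ≤ |u 1 j| := by
      have := mul_le_mul_of_nonneg_left h1 (abs_nonneg (u 1 j))
      simpa using this
    have h3 := mul_le_mul_of_nonneg_left h2 (abs_nonneg (u 0 j))
    nlinarith [sq_nonneg (|u 0 j| - |u 1 j|), sq_abs (u 0 j), sq_abs (u 1 j)]
  refine (Finset.sum_le_sum fun j _ => h j).trans ?_
  rw [← Finset.sum_div, Finset.sum_add_distrib]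
  linarith [hu 0, hu 1]

theorem gbound_init {ι : Type} [Fintype ι] {N : ℕ} (hN : 1 ≤ N)
    (T : MultilinearMap ℝ (fun _ : Fin (N + 1) => ι → ℝ) ℝ) : ∃ B, GBound T B := by
  classical
  refine ⟨∑ r : Fin (N + 1) → ι, |T (fun l => Pi.single (r l) 1)|, ?_⟩
  intro J _ x hx
  have h1 : ∀ j, T (fun l => x l j)
      = ∑ r : Fin (N + 1) → ι, (∏ l, x l j (r l)) * T (fun l => Pi.single (r l) 1) := by
    intro j
    have : (fun l => x l j) = fun l => ∑ p, x l j p • (Pi.single p (1 : ℝ) : ι → ℝ) := by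
      funext l
      exact pi_eq_sum_univ' (x l j)
    rw [this, MultilinearMap.map_sum]
    refine Finset.sum_congr rfl fun r _ => ?_
    rw [T.map_smul_univ (fun l => x l j (r l)) (fun l => Pi.single (r l) 1), smul_eq_mul]
  simp_rw [h1]
  rw [Finset.sum_comm]
  refine (Finset.abs_sum_le_sum_abs _ _).trans (Finset.sum_le_sum fun r _ => ?_)
  rw [← Finset.sum_mul, abs_mul]
  have := sum_prod_le hN (fun l j => x l j (r l)) (fun l => hx l (r l))
  have h2 := (Finset.abs_sum_le_sum_abs (fun j => ∏ l, x l j (r l)) Finset.univ).trans this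
  nlinarith [abs_nonneg (T (fun l => Pi.single (r l) 1))]

theorem gbound {ι : Type} [Fintype ι] {N : ℕ} (hN : 1 ≤ N)
    (T : MultilinearMap ℝ (fun _ : Fin (N + 1) => ι → ℝ) ℝ) (M : ℝ) (hM : 0 ≤ M)
    (hT : ∀ v, |T v| ≤ M * ∏ l, ‖v l‖) : GBound T (8 * (M * 2 ^ (N + 1))) := by
  obtain ⟨B, hB⟩ := gbound_init hN T
  have key : ∀ s : ℕ, GBound T (8 * (M * 2 ^ (N + 1)) + (7 / 8) ^ s * (B - 8 * (M * 2 ^ (N + 1)))) := by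
    intro s
    induction s with
    | zero => simpa using hB
    | succ s ih =>
      have := gbound_step T M _ hM hT ih
      convert this using 1
      ring
  intro J _ x hx
  have hlim : Tendsto (fun s : ℕ => 8 * (M * 2 ^ (N + 1))
      + (7 / 8 : ℝ) ^ s * (B - 8 * (M * 2 ^ (N + 1)))) atTop
      (nhds (8 * (M * 2 ^ (N + 1)) + 0 * (B - 8 * (M * 2 ^ (N + 1))))) :=
    ((tendsto_pow_atTop_nhds_zero_of_lt_one (by norm_num) (by norm_num)).mul_const _).const_add _
  rw [zero_mul, add_zero] at hlim
  exact ge_of_tendsto' hlim fun s => key s J _ x hx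

/-! ### Transfer to `c₀` -/

/-- The space `c₀`. -/
abbrev C0 := ZeroAtInftyContinuousMap ℕ ℝ

theorem C0.norm_le {f : C0} {C : ℝ} (hC : 0 ≤ C) : ‖f‖ ≤ C ↔ ∀ p, |f p| ≤ C := by
  rw [← ZeroAtInftyContinuousMap.norm_toBCF_eq_norm, BoundedContinuousFunction.norm_le hC]
  rfl

theorem C0.abs_le (f : C0) (p : ℕ) : |f p| ≤ ‖f‖ := (C0.norm_le (norm_nonneg f)).1 le_rfl p

/-- Finitely supported sequences in `c₀`. -/
def C0.mkFin (f : ℕ → ℝ) (m : ℕ) (hf : ∀ p, m ≤ p → f p = 0) : C0 where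
  toFun := f
  continuous_toFun := continuous_of_discreteTopology
  zero_at_infty' := by
    rw [Filter.cocompact_eq_cofinite, Nat.cofinite_eq_atTop]
    refine tendsto_const_nhds.congr' ?_
    filter_upwards [eventually_ge_atTop m] with p hp
    exact (hf p hp).symm

@[simp] theorem C0.mkFin_apply (f : ℕ → ℝ) (m : ℕ) (hf : ∀ p, m ≤ p → f p = 0) (p : ℕ) :
    C0.mkFin f m hf p = f p := rfl

/-- Evaluation functional. -/
noncomputable def C0.ev (p : ℕ) : C0 →L[ℝ] ℝ :=
  LinearMap.mkContinuous
    { toFun := fun f => f p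
      map_add' := fun _ _ => rfl
      map_smul' := fun _ _ => rfl } 1 (fun f => by simpa using C0.abs_le f p)

@[simp] theorem C0.ev_apply (p : ℕ) (f : C0) : C0.ev p f = f p := rfl

theorem C0.ev_norm (p : ℕ) : ‖C0.ev p‖ ≤ 1 :=
  LinearMap.mkContinuous_norm_le _ zero_le_one _

theorem C0.sum_smul_apply {k : ℕ} (c : Fin k → ℝ) (x : Fin k → C0) (p : ℕ) :
    (∑ j, c j • x j) p = ∑ j, c j * x j p := by
  rw [← C0.ev_apply, map_sum]
  rfl

/-- Inclusion of `ℝ^m` in `c₀`. -/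
noncomputable def C0.incl (m : ℕ) : (Fin m → ℝ) →ₗ[ℝ] C0 where
  toFun v := C0.mkFin (fun p => if h : p < m then v ⟨p, h⟩ else 0) m
    (fun p hp => by simp [Nat.not_lt.2 hp])
  map_add' v w := by
    ext p
    by_cases h : p < m <;> simp [h]
  map_smul' c v := by
    ext p
    by_cases h : p < m <;> simp [h]

theorem C0.incl_apply (m : ℕ) (v : Fin m → ℝ) (p : ℕ) :
    C0.incl m v p = if h : p < m then v ⟨p, h⟩ else 0 := rfl

theorem C0.incl_norm (m : ℕ) (v : Fin m → ℝ) : ‖C0.incl m v‖ ≤ ‖v‖ := by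
  rw [C0.norm_le (norm_nonneg _)]
  intro p
  rw [C0.incl_apply]
  split_ifs with h
  · exact norm_le_pi_norm v ⟨p, h⟩
  · simp

theorem C0.tendsto_trunc (f : C0) :
    Tendsto (fun m => C0.incl m (fun i => f i)) atTop (nhds f) := by
  rw [Metric.tendsto_atTop]
  intro ε hε
  have h := f.zero_at_infty'
  rw [Filter.cocompact_eq_cofinite, Nat.cofinite_eq_atTop, Metric.tendsto_atTop] at h
  obtain ⟨m, hm⟩ := h (ε / 2) (by positivity)
  refine ⟨m, fun k hk => ?_⟩
  rw [dist_eq_norm]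
  refine lt_of_le_of_lt (b := ε / 2) ?_ (by linarith)
  rw [C0.norm_le (by positivity)]
  intro p
  rw [ZeroAtInftyContinuousMap.sub_apply, C0.incl_apply]
  split_ifs with hp
  · simp; positivity
  · have := hm p (by omega)
    rw [dist_zero_right, Real.norm_eq_abs] at this
    rw [zero_sub, abs_neg]
    exact this.le

theorem C0.groth {N : ℕ} (hN : 1 ≤ N)
    (T : ContinuousMultilinearMap ℝ (fun _ : Fin (N + 1) => C0) ℝ) {k : ℕ}
    (x : Fin (N + 1) → Fin k → C0) (hx : ∀ l p, ∑ j, x l j p ^ 2 ≤ 1) :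
    |∑ j, T (fun l => x l j)| ≤ 8 * (‖T‖ * 2 ^ (N + 1)) := by
  have h : ∀ m : ℕ, |∑ j, T (fun l => C0.incl m (fun i => x l j i))|
      ≤ 8 * (‖T‖ * 2 ^ (N + 1)) := by
    intro m
    refine gbound hN (T.toMultilinearMap.compLinearMap (fun _ => C0.incl m)) ‖T‖ (norm_nonneg T)
      ?_ (Fin k) inferInstance (fun l j i => x l j i) (fun l p => hx l p)
    intro v
    refine (T.le_opNorm (fun l => C0.incl m (v l))).trans ?_
    refine mul_le_mul_of_nonneg_left ?_ (norm_nonneg _)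
    exact Finset.prod_le_prod (fun _ _ => norm_nonneg _) fun l _ => C0.incl_norm m (v l)
  have hlim : Tendsto (fun m : ℕ => |∑ j, T (fun l => C0.incl m (fun i => x l j i))|) atTop
      (nhds |∑ j, T (fun l => x l j)|) := by
    refine (tendsto_finsetSum _ fun j _ => ?_).abs
    refine (T.cont.tendsto _).comp ?_
    rw [tendsto_pi_nhds]
    intro l
    exact C0.tendsto_trunc (x l j)
  exact le_of_tendsto' hlim h

theorem weak_bdd {E : Type*} [NormedAddCommGroup E] [NormedSpace ℝ E] {k : ℕ} (x : Fin k → E) :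
    BddAbove {s : ℝ | ∃ φ : E →L[ℝ] ℝ, ‖φ‖ ≤ 1 ∧
      s = (∑ j, |φ (x j)| ^ (2 : ℝ)) ^ (1 / (2 : ℝ))} := by
  refine ⟨(∑ j, ‖x j‖ ^ (2 : ℝ)) ^ (1 / (2 : ℝ)), ?_⟩
  rintro s ⟨φ, hφ, rfl⟩
  have : ∀ j, |φ (x j)| ≤ ‖x j‖ := fun j => by
    have := φ.le_of_opNorm_le hφ (x j)
    simpa using this
  gcongr
  exact this _

theorem weak_nonneg {E : Type*} [NormedAddCommGroup E] [NormedSpace ℝ E] {k : ℕ} (x : Fin k → E) :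
    0 ≤ weakNorm 2 x := by
  apply Real.sSup_nonneg
  rintro s ⟨φ, hφ, rfl⟩
  positivity

theorem weak_coord {k : ℕ} (x : Fin k → C0) (p : ℕ) :
    ∑ j, x j p ^ 2 ≤ weakNorm 2 x ^ 2 := by
  have h : (∑ j, |C0.ev p (x j)| ^ (2 : ℝ)) ^ (1 / (2 : ℝ)) ≤ weakNorm 2 x :=
    le_csSup (weak_bdd x) ⟨C0.ev p, C0.ev_norm p, rfl⟩
  rw [← Real.sqrt_eq_rpow] at h
  simp only [Real.rpow_two, sq_abs, C0.ev_apply] at h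
  exact (Real.sqrt_le_left (weak_nonneg x)).1 h

theorem weak_le {k : ℕ} (x : Fin k → C0) (δ : ℝ) (hδ : 0 ≤ δ) (hx : ∀ p, ∑ j, x j p ^ 2 ≤ δ ^ 2) :
    weakNorm 2 x ≤ δ := by
  refine Real.sSup_le ?_ hδ
  rintro s ⟨φ, hφ, rfl⟩
  rw [← Real.sqrt_eq_rpow]
  simp only [Real.rpow_two, sq_abs]
  set A := ∑ j, φ (x j) ^ 2 with hA
  have hA0 : 0 ≤ A := Finset.sum_nonneg fun _ _ => by positivity
  have h1 : A = φ (∑ j, φ (x j) • x j) := by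
    rw [map_sum, hA]
    refine Finset.sum_congr rfl fun j _ => ?_
    rw [map_smul, smul_eq_mul, sq]
  have h2 : ‖∑ j, φ (x j) • x j‖ ≤ √A * δ := by
    rw [C0.norm_le (by positivity)]
    intro p
    have e : (∑ j, φ (x j) • x j) p = ∑ j, φ (x j) * x j p := by
      exact C0.sum_smul_apply _ _ _
    rw [e]
    apply abs_le_of_sq_le_sq _ (by positivity)
    rw [mul_pow, Real.sq_sqrt hA0]
    exact (Finset.sum_mul_sq_le_sq_mul_sq _ _ _).trans
      (mul_le_mul_of_nonneg_left (hx p) hA0)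
  have h3 : A ≤ √A * δ := by
    have := φ.le_of_opNorm_le hφ (∑ j, φ (x j) • x j)
    rw [← h1, one_mul, Real.norm_of_nonneg hA0] at this
    exact this.trans h2
  by_contra hc
  push Not at hc
  have := Real.mul_self_sqrt hA0
  nlinarith

theorem rademacher_abs (j : ℕ) (t : ℝ) : rademacher j t = 1 ∨ rademacher j t = -1 := by
  unfold rademacher
  split_ifs <;> simp

theorem part1_aux {N : ℕ} (hN : 1 ≤ N)
    (T : ContinuousMultilinearMap ℝ (fun _ : Fin (N + 1) => C0) ℝ) {k : ℕ}
    (x : Fin k → C0) (e : Fin k → ℝ) (he : ∀ j, e j ^ 2 = 1) (w : ℝ) (hw : 0 < w)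
    (hx : ∀ p, ∑ j, x j p ^ 2 ≤ w ^ 2) :
    |∑ j, e j * T (fun _ => x j)| ≤ 8 * (‖T‖ * 2 ^ (N + 1)) * w ^ (N + 1) := by
  have h := C0.groth hN T (fun l j => ((if l = 0 then e j else 1) * w⁻¹) • x j) (by
    intro l p
    have : ∑ j, (((if l = 0 then e j else 1) * w⁻¹) • x j) p ^ 2
        = (w ^ 2)⁻¹ * ∑ j, x j p ^ 2 := by
      rw [Finset.mul_sum]
      refine Finset.sum_congr rfl fun j _ => ?_
      rw [ZeroAtInftyContinuousMap.smul_apply, smul_eq_mul, mul_pow, mul_pow, inv_pow]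
      have : (if l = 0 then e j else 1) ^ 2 = 1 := by split_ifs <;> simp [he]
      rw [this, one_mul]
    rw [this, inv_mul_le_iff₀ (by positivity), mul_one]
    exact hx p)
  have h2 : ∀ j, T (fun l => ((if l = 0 then e j else 1) * w⁻¹) • x j)
      = (w ^ (N + 1))⁻¹ * (e j * T (fun _ => x j)) := by
    intro j
    rw [T.map_smul_univ (fun l => (if l = 0 then e j else 1) * w⁻¹) (fun _ => x j), smul_eq_mul,
      Finset.prod_mul_distrib]
    simp
    ring
  simp_rw [h2] at h
  rw [← Finset.mul_sum, abs_mul, abs_of_pos (by positivity), inv_mul_le_iff₀ (by positivity)] at h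
  linarith

theorem part1 {N : ℕ} (hN : 1 ≤ N)
    (T : ContinuousMultilinearMap ℝ (fun _ : Fin (N + 1) => C0) C0) :
    AlmostSummingAt 2 (fun x => T fun _ => x) 0 := by
  refine ⟨8 * (‖T‖ * 2 ^ (N + 1)) + 1, by positivity, 1, one_pos, N + 1, Nat.succ_pos N,
    ?_⟩
  intro k x _
  have hT0 : T (fun _ => (0 : C0)) = 0 := T.map_coord_zero 0 rfl
  simp only [zero_add, hT0, sub_zero]
  set w := weakNorm 2 x with hwdef
  have hw0 : 0 ≤ w := weak_nonneg x
  have hx := weak_coord x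
  rw [← hwdef] at hx
  set C := 8 * (‖T‖ * 2 ^ (N + 1)) with hC
  have hC0 : 0 ≤ C := by positivity
  have key : ∀ t : ℝ, ‖∑ j : Fin k, rademacher (j : ℕ) t • T (fun _ => x j)‖
      ≤ C * w ^ (N + 1) := by
    intro t
    rcases hw0.eq_or_lt with h0 | hpos
    · have hz : ∀ j, x j = 0 := by
        intro j
        ext p
        have h1 := (Finset.single_le_sum (f := fun j => x j p ^ 2) (fun _ _ => by positivity)
          (Finset.mem_univ j)).trans (hx p)
        rw [← h0] at h1
        have : x j p ^ 2 = 0 := le_antisymm (by simpa using h1) (by positivity)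
        simpa using this
      simp only [hz, hT0, smul_zero, Finset.sum_const_zero, norm_zero]
      positivity
    · rw [C0.norm_le (by positivity)]
      intro p
      have e : (∑ j : Fin k, rademacher (j : ℕ) t • T (fun _ => x j)) p
          = ∑ j : Fin k, rademacher (j : ℕ) t *
            ((C0.ev p).compContinuousMultilinearMap T) (fun _ => x j) := by
        exact C0.sum_smul_apply _ _ _
      rw [e]
      refine (part1_aux hN _ x (fun j => rademacher (j : ℕ) t) (fun j => ?_) w hpos hx).trans ?_
      · rcases rademacher_abs j t with h | h <;> simp [h]
      · rw [hC]
        have : ‖(C0.ev p).compContinuousMultilinearMap T‖ ≤ ‖T‖ := by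
          refine (ContinuousLinearMap.norm_compContinuousMultilinearMap_le _ _).trans ?_
          nlinarith [C0.ev_norm p, norm_nonneg T]
        gcongr
  have hint : ∫ t in (0 : ℝ)..1, ‖∑ j : Fin k, rademacher (j : ℕ) t • T (fun _ => x j)‖ ^ 2
      ≤ (C * w ^ (N + 1)) ^ 2 := by
    have := intervalIntegral.norm_integral_le_of_norm_le_const (a := 0) (b := 1)
      (C := (C * w ^ (N + 1)) ^ 2)
      (f := fun t => ‖∑ j : Fin k, rademacher (j : ℕ) t • T (fun _ => x j)‖ ^ 2) (by
        intro t _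
        rw [norm_pow, norm_norm]
        gcongr
        exact key t)
    simp only [sub_zero, abs_one, mul_one] at this
    exact (le_abs_self _).trans this
  have hrad : radNorm (fun j => T (fun _ => x j)) ≤ C * w ^ (N + 1) := by
    unfold radNorm
    rw [← Real.sqrt_eq_rpow]
    exact Real.sqrt_le_iff.2 ⟨by positivity, hint⟩
  refine hrad.trans ?_
  have : 0 ≤ w ^ (N + 1) := by positivity
  nlinarith

/-! ### The counterexample -/

/-- The multilinear map `(x₁,…,xₙ) ↦ x₁(0)⋯xₙ₋₁(0) xₙ`. -/
noncomputable def badT (N : ℕ) : ContinuousMultilinearMap ℝ (fun _ : Fin (N + 1) => C0) C0 :=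
  ContinuousMultilinearMap.uncurryRight (Ei := fun _ : Fin (N + 1) => C0)
    (((ContinuousMultilinearMap.mkPiAlgebra ℝ (Fin N) ℝ).compContinuousLinearMap
      (fun _ => C0.ev 0)).smulRight (ContinuousLinearMap.id ℝ C0))

theorem badT_apply (N : ℕ) (x : C0) : badT N (fun _ => x) = (x 0) ^ N • x := by
  unfold badT
  rw [ContinuousMultilinearMap.uncurryRight_apply]
  simp [Fin.init]

/-- The vertices of the cube, scaled. -/
noncomputable def cube (k : ℕ) (s : ℝ) (j : Fin k) : C0 :=
  C0.mkFin (fun p => if p = 0 then 0 else if p - 1 < 2 ^ k then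
    s * sgnB ((p - 1).testBit j) else 0) (2 ^ k + 1) (fun p hp => by
      have h1 : p ≠ 0 := by intro h; subst h; simp at hp
      have h2 : ¬ (p - 1 < 2 ^ k) := not_lt.2 (Nat.le_sub_one_of_lt hp)
      simp only [if_neg h1, if_neg h2])

theorem cube_zero (k : ℕ) (s : ℝ) (j : Fin k) : cube k s j 0 = 0 := by simp [cube]

theorem cube_le (k : ℕ) (s : ℝ) (j : Fin k) (p : ℕ) : cube k s j p ^ 2 ≤ s ^ 2 := by
  simp only [cube, C0.mkFin_apply]
  split_ifs
  · simp; positivity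
  · rw [mul_pow, sq (sgnB _), sgnB_sq, mul_one]
  · simp; positivity

theorem cube_rad (k : ℕ) (s : ℝ) (hs : 0 ≤ s) (t : ℝ) :
    ‖∑ j : Fin k, rademacher (j : ℕ) t • cube k s j‖ = k * s := by
  have e : ∀ p, (∑ j : Fin k, rademacher (j : ℕ) t • cube k s j) p
      = ∑ j : Fin k, rademacher (j : ℕ) t * cube k s j p := by
    intro p
    exact C0.sum_smul_apply _ _ _
  apply le_antisymm
  · rw [C0.norm_le (by positivity)]
    intro p
    rw [e]
    refine (Finset.abs_sum_le_sum_abs _ _).trans ?_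
    have : ∀ j : Fin k, |rademacher (j : ℕ) t * cube k s j p| ≤ s := by
      intro j
      have h1 : |rademacher (j : ℕ) t| = 1 := by
        rcases rademacher_abs j t with h | h <;> simp [h]
      rw [abs_mul, h1, one_mul]
      exact abs_le_of_sq_le_sq (cube_le k s j p) hs
    refine (Finset.sum_le_sum fun j _ => this j).trans ?_
    simp
  · classical
    let f : Fin k → Bool := fun j => decide (rademacher (j : ℕ) t = 1)
    have h := C0.abs_le (∑ j : Fin k, rademacher (j : ℕ) t • cube k s j) (Nat.ofBits f + 1)
    refine le_trans ?_ h
    rw [e]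
    refine le_trans (le_of_eq ?_) (le_abs_self _)
    have : ∀ j : Fin k, rademacher (j : ℕ) t * cube k s j (Nat.ofBits f + 1) = s := by
      intro j
      simp only [cube, C0.mkFin_apply, Nat.add_sub_cancel]
      rw [if_neg (by omega), if_pos (Nat.ofBits_lt_two_pow f), Nat.testBit_ofBits_lt f j j.2]
      rcases rademacher_abs j t with h | h
      · simp [f, h, sgnB]
      · simp [f, h, sgnB]; norm_num
    rw [Finset.sum_congr rfl fun j _ => this j]
    simp

theorem part2 (N : ℕ) : ¬ ∀ a, AlmostSummingAt 2 (fun x => badT N fun _ => x) a := by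
  intro H
  let a : C0 := C0.mkFin (fun p => if p = 0 then 1 else 0) 1
    (fun p hp => if_neg (by omega))
  have ha : a 0 = 1 := by simp [a]
  obtain ⟨C, hC, ε, hε, r, hr, h⟩ := H a
  -- scale
  set δ := ε / 2 with hδ
  have hδ0 : 0 < δ := by positivity
  obtain ⟨m, hm⟩ := exists_nat_gt (C * δ ^ r / δ)
  have hm0 : (0 : ℝ) < m := lt_of_le_of_lt (by positivity) hm
  set s := δ / m with hs
  have hs0 : 0 < s := by positivity
  have hw : weakNorm 2 (cube (m ^ 2) s) ≤ δ := by
    refine weak_le _ _ hδ0.le fun p => ?_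
    refine (Finset.sum_le_sum fun j _ => cube_le _ s j p).trans (le_of_eq ?_)
    simp [hs]
    field_simp
  have h1 := h (m ^ 2) (cube (m ^ 2) s) (by linarith)
  have h2 : ∀ j, badT N (fun _ => a + cube (m ^ 2) s j) - badT N (fun _ => a)
      = cube (m ^ 2) s j := by
    intro j
    rw [badT_apply, badT_apply, ZeroAtInftyContinuousMap.add_apply, cube_zero, ha]
    simp
  simp only [h2] at h1
  have h3 : radNorm (cube (m ^ 2) s) = m * δ := by
    unfold radNorm
    simp only [cube_rad _ _ hs0.le]
    rw [← Real.sqrt_eq_rpow]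
    simp only [intervalIntegral.integral_const, sub_zero, one_smul]
    rw [Real.sqrt_sq (by positivity), hs]
    push_cast
    field_simp
  have h4 : weakNorm 2 (cube (m ^ 2) s) ^ r ≤ δ ^ r :=
    pow_le_pow_left₀ (weak_nonneg _) hw r
  have h5 : (m : ℝ) * δ ≤ C * δ ^ r := by
    rw [← h3]
    exact h1.trans (mul_le_mul_of_nonneg_left h4 hC.le)
  rw [div_lt_iff₀ hδ0] at hm
  linarith

theorem stmt17 (n : ℕ) (hn : 2 ≤ n) :
    (∀ T : ContinuousMultilinearMap ℝ
        (fun _ : Fin n => ZeroAtInftyContinuousMap ℕ ℝ) (ZeroAtInftyContinuousMap ℕ ℝ),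
        AlmostSummingAt 2 (fun x => T fun _ => x) 0) ∧
      ∃ T : ContinuousMultilinearMap ℝ
          (fun _ : Fin n => ZeroAtInftyContinuousMap ℕ ℝ) (ZeroAtInftyContinuousMap ℕ ℝ),
        ¬ ∀ a, AlmostSummingAt 2 (fun x => T fun _ => x) a := by 
  obtain ⟨N, rfl⟩ : ∃ N, n = N + 1 := ⟨n - 1, by omega⟩
  exact ⟨fun T => part1 (by omega) T, badT N, part2 N⟩
end
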